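/- arXiv:1308.4390 — 2 statements merged into one kernel-verified Lean document; each statement's English description precedes it below -/
import Mathlib

section
/- Let g be a symmetric invertible 4×4 real matrix with det g < 0 and let W have Weyl symmetries with respect to g. Then for all a,b,c,h in Fin 4: (1/4) Σ_{p,q,r,s,u,v} η^{pqr}{}_s η^{suv}{}_h g_{ra} ( − Σ_d W_{pqdb} W_{uv}{}^{d}{}_c − Σ_d W_{pqdc} W_{uv}{}^{d}{}_b + (1/2) g_{bc} Σ_{e,d} W_{pqed} W_{uv}{}^{ed} ) = T_{abch}, where T is the Bel-Robinson tensor of W. (This is the component form of the Proposition stating that the Hodge dual of the Bel-Robinson 3-form 𝒯_{abc} = Ω^{ed}{}_{abc}∧𝒲_{ed} equals θ^{d} T_{abcd}.) -/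
open Finset

/-- The Levi-Civita alternating symbol on `Fin 4`: the sign of `(a,b,c,d)` as a
permutation of `(0,1,2,3)`, and `0` if two indices coincide. -/
noncomputable def eps4 (a b c d : Fin 4) : ℝ :=
  (((b : ℕ) : ℝ) - ((a : ℕ) : ℝ)) * (((c : ℕ) : ℝ) - ((a : ℕ) : ℝ)) *
    (((d : ℕ) : ℝ) - ((a : ℕ) : ℝ)) * (((c : ℕ) : ℝ) - ((b : ℕ) : ℝ)) *
    (((d : ℕ) : ℝ) - ((b : ℕ) : ℝ)) * (((d : ℕ) : ℝ) - ((c : ℕ) : ℝ)) / 12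

/-- The volume element `η_{abcd} = √(−det g)·ε_{abcd}`. -/
noncomputable def eta4 (g : Fin 4 → Fin 4 → ℝ) (a b c d : Fin 4) : ℝ :=
  Real.sqrt (-(Matrix.of g).det) * eps4 a b c d

/-- `η^{pqr}{}_s`, obtained by raising the first three indices of `η` with `g^{ab}`. -/
noncomputable def etaUp3 (g ginv : Fin 4 → Fin 4 → ℝ) (p q r s : Fin 4) : ℝ :=
  ∑ a, ∑ b, ∑ c, ginv p a * ginv q b * ginv r c * eta4 g a b c s

/-- The Bel-Robinson tensor of `W`:
`T_{ablm} = W_{ajmk} W_b{}^{j}{}_l{}^{k} + W_{ajlk} W_b{}^{j}{}_m{}^{k}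
  − (1/8) g_{ab} g_{lm} W_{dfgh} W^{dfgh}`. -/
noncomputable def belRobinson (g ginv : Fin 4 → Fin 4 → ℝ)
    (W : Fin 4 → Fin 4 → Fin 4 → Fin 4 → ℝ) (a b l m : Fin 4) : ℝ :=
  (∑ j, ∑ k, W a j m k * (∑ p, ∑ q, ginv j p * ginv k q * W b p l q))
    + (∑ j, ∑ k, W a j l k * (∑ p, ∑ q, ginv j p * ginv k q * W b p m q))
    - (1 / 8) * g a b * g l m *
      (∑ d, ∑ f, ∑ e, ∑ h,
        W d f e h *
          (∑ p, ∑ q, ∑ r, ∑ s, ginv d p * ginv f q * ginv e r * ginv h s * W p q r s))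

/-- The trace `g^{ij} F_{ij}` of a two-index array with respect to the inverse metric. -/
noncomputable def metricTrace (ginv : Fin 4 → Fin 4 → ℝ) (F : Fin 4 → Fin 4 → ℝ) : ℝ :=
  ∑ i, ∑ j, ginv i j * F i j

section Trace

variable {g ginv : Fin 4 → Fin 4 → ℝ}

theorem metricTrace_congr {F G : Fin 4 → Fin 4 → ℝ} (h : ∀ i j, F i j = G i j) :
    metricTrace ginv F = metricTrace ginv G :=
  congrArg _ (funext fun i => funext fun j => h i j)

theorem metricTrace_add (F G : Fin 4 → Fin 4 → ℝ) :
    metricTrace ginv (fun i j => F i j + G i j) = metricTrace ginv F + metricTrace ginv G := by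
  simp only [metricTrace, mul_add, sum_add_distrib]

theorem metricTrace_sub (F G : Fin 4 → Fin 4 → ℝ) :
    metricTrace ginv (fun i j => F i j - G i j) = metricTrace ginv F - metricTrace ginv G := by
  simp only [metricTrace, mul_sub, sum_sub_distrib]

theorem metricTrace_neg (F : Fin 4 → Fin 4 → ℝ) :
    metricTrace ginv (fun i j => -F i j) = -metricTrace ginv F := by
  simp only [metricTrace, mul_neg, sum_neg_distrib]

theorem metricTrace_const_mul (c : ℝ) (F : Fin 4 → Fin 4 → ℝ) :
    metricTrace ginv (fun i j => c * F i j) = c * metricTrace ginv F := by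
  simp only [metricTrace, mul_sum]
  exact sum_congr rfl fun i _ => sum_congr rfl fun j _ => by ring

theorem metricTrace_zero : metricTrace ginv (fun _ _ => 0) = 0 := by
  simp [metricTrace]

theorem metricTrace_comm (F : Fin 4 → Fin 4 → Fin 4 → Fin 4 → ℝ) :
    metricTrace ginv (fun i j => metricTrace ginv (fun k l => F i j k l)) =
      metricTrace ginv (fun k l => metricTrace ginv (fun i j => F i j k l)) := by
  have h : ∀ F : Fin 4 → Fin 4 → ℝ,
      metricTrace ginv F = ∑ x : Fin 4 × Fin 4, ginv x.1 x.2 * F x.1 x.2 := fun F => by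
    rw [Fintype.sum_prod_type]; rfl
  simp only [h, mul_sum]
  rw [sum_comm]
  exact sum_congr rfl fun i _ => sum_congr rfl fun j _ => by ring

theorem metricTrace_swap (hs : ∀ a b, ginv a b = ginv b a) (F : Fin 4 → Fin 4 → ℝ) :
    metricTrace ginv (fun i j => F j i) = metricTrace ginv F := by
  unfold metricTrace
  rw [sum_comm]
  exact sum_congr rfl fun i _ => sum_congr rfl fun j _ => by rw [hs]

theorem metricTrace_metric_mul_left (hg : ∀ a b, g a b = g b a)
    (hs : ∀ a b, ginv a b = ginv b a)
    (hginv : ∀ a b, ∑ c, ginv a c * g c b = if a = b then (1 : ℝ) else 0)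
    (x : Fin 4) (F : Fin 4 → ℝ) :
    metricTrace ginv (fun i j => g x i * F j) = F x := by
  unfold metricTrace
  rw [sum_comm]
  have h : ∀ j, ∑ i, ginv i j * (g x i * F j) = (if j = x then 1 else 0) * F j := fun j => by
    rw [← hginv, sum_mul]
    exact sum_congr rfl fun i _ => by rw [hs i j, hg x i]; ring
  simp [h]

theorem metricTrace_metric_mul_right (hg : ∀ a b, g a b = g b a)
    (hs : ∀ a b, ginv a b = ginv b a)
    (hginv : ∀ a b, ∑ c, ginv a c * g c b = if a = b then (1 : ℝ) else 0)
    (x : Fin 4) (F : Fin 4 → ℝ) :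
    metricTrace ginv (fun i j => g x j * F i) = F x := by
  rw [← metricTrace_metric_mul_left hg hs hginv x F, ← metricTrace_swap hs]

end Trace

section Inverse

variable {g ginv : Fin 4 → Fin 4 → ℝ}

theorem inverseMetric_mul
    (hginv : ∀ a b, ∑ c, ginv a c * g c b = if a = b then (1 : ℝ) else 0) :
    Matrix.of ginv * Matrix.of g = 1 := by
  ext a b
  simp [Matrix.mul_apply, Matrix.one_apply, hginv]

theorem inverseMetric_symm (hg : ∀ a b, g a b = g b a)
    (hginv : ∀ a b, ∑ c, ginv a c * g c b = if a = b then (1 : ℝ) else 0) (a b : Fin 4) :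
    ginv a b = ginv b a := by
  have h := inverseMetric_mul hginv
  have hT : (Matrix.of g).transpose = Matrix.of g := by
    ext i j; exact hg j i
  have h2 : (Matrix.of ginv).transpose * Matrix.of g = 1 := by
    conv_lhs => rw [← hT]
    rw [← Matrix.transpose_mul, mul_eq_one_comm.mp h, Matrix.transpose_one]
  have h3 : (Matrix.of ginv).transpose = Matrix.of ginv :=
    left_inv_eq_right_inv h2 (mul_eq_one_comm.mp h)
  exact congrFun (congrFun h3 b) a

theorem det_mul_inverseMetric
    (hginv : ∀ a b, ∑ c, ginv a c * g c b = if a = b then (1 : ℝ) else 0) (a b : Fin 4) :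
    (Matrix.of g).det * ginv a b = (Matrix.of g).adjugate a b := by
  have h : (Matrix.of g).adjugate = (Matrix.of g).det • Matrix.of ginv := by
    calc _ = (Matrix.of ginv * Matrix.of g) * (Matrix.of g).adjugate := by
          rw [inverseMetric_mul hginv, one_mul]
      _ = _ := by rw [mul_assoc, Matrix.mul_adjugate, Matrix.mul_smul, mul_one]
  rw [h]; rfl

/-- A three-index alternating array on `Fin 4` vanishes if it does on increasing triples. -/
theorem alternating_eq_zero {F : Fin 4 → Fin 4 → Fin 4 → ℝ}
    (h₁ : ∀ a b c, F a b c = -F b a c) (h₂ : ∀ a b c, F a b c = -F a c b)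
    (h012 : F 0 1 2 = 0) (h013 : F 0 1 3 = 0) (h023 : F 0 2 3 = 0) (h123 : F 1 2 3 = 0)
    (a b c : Fin 4) : F a b c = 0 := by
  fin_cases a <;> fin_cases b <;> fin_cases c <;> simp <;> grind

/-- The determinant of the `3 × 3` array of products of two triples of index vectors. -/
def gram3 (g : Fin 4 → Fin 4 → ℝ) (p q a u v h : Fin 4) : ℝ :=
  g p u * (g q v * g a h - g q h * g a v) - g p v * (g q u * g a h - g q h * g a u)
    + g p h * (g q u * g a v - g q v * g a u)

theorem eps4_swap₁₂ (a b c d : Fin 4) : eps4 a b c d = -eps4 b a c d := by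
  unfold eps4; ring

theorem eps4_swap₂₃ (a b c d : Fin 4) : eps4 a b c d = -eps4 a c b d := by
  unfold eps4; ring

theorem eps4_swap₃₄ (a b c d : Fin 4) : eps4 a b c d = -eps4 a b d c := by
  unfold eps4; ring

set_option maxHeartbeats 4000000 in
theorem adjugate_contract_eps4 (p q a u v h : Fin 4) :
    ∑ s, ∑ t, (Matrix.of g).adjugate t s * (eps4 p q a s * eps4 u v h t) =
      gram3 g p q a u v h := by
  rw [← sub_eq_zero]
  refine alternating_eq_zero (F := fun p q a =>
    ∑ s, ∑ t, (Matrix.of g).adjugate t s * (eps4 p q a s * eps4 u v h t) -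
      gram3 g p q a u v h) ?_ ?_ ?_ ?_ ?_ ?_ p q a
  · intro p q a
    simp only [eps4_swap₁₂ p q a, neg_mul, mul_neg, sum_neg_distrib, gram3]
    ring
  · intro p q a
    simp only [eps4_swap₂₃ p q a, neg_mul, mul_neg, sum_neg_distrib, gram3]
    ring
  all_goals
    refine alternating_eq_zero (F := fun u v h =>
      ∑ s, ∑ t, (Matrix.of g).adjugate t s * (eps4 _ _ _ s * eps4 u v h t) -
        gram3 g _ _ _ u v h) ?_ ?_ ?_ ?_ ?_ ?_ u v h
    · intro u v h
      simp only [eps4_swap₁₂ u v h, mul_neg, sum_neg_distrib, gram3]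
      ring
    · intro u v h
      simp only [eps4_swap₂₃ u v h, mul_neg, sum_neg_distrib, gram3]
      ring
    all_goals
      norm_num [Fin.sum_univ_four, eps4]
      simp [Matrix.adjugate_apply, Matrix.det_succ_row_zero, Fin.sum_univ_succ, gram3,
        Matrix.updateRow_apply, Fin.succAbove]
      ring

end Inverse

section Lanczos

variable {g ginv : Fin 4 → Fin 4 → ℝ}

/-- The antisymmetrization of `M_{hi}{}^{cd} N_j{}^e` over the two triples of indices, up to
scale, when `M` is antisymmetric in each pair. -/
def lanczos (M : Fin 4 → Fin 4 → Fin 4 → Fin 4 → ℝ) (N : Fin 4 → Fin 4 → ℝ)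
    (h i j c d e : Fin 4) : ℝ :=
  M h i c d * N j e + M h i d e * N j c + M h i e c * N j d
    + (M i j c d * N h e + M i j d e * N h c + M i j e c * N h d)
    + (M j h c d * N i e + M j h d e * N i c + M j h e c * N i d)

theorem lanczos_one_eq_zero {M : Fin 4 → Fin 4 → Fin 4 → Fin 4 → ℝ}
    (h₁ : ∀ a b c d, M a b c d = -M b a c d) (h₂ : ∀ a b c d, M a b c d = -M a b d c)
    (htr : ∀ b d, ∑ a, M a b a d = 0) (h i j c d e : Fin 4) :
    lanczos M (fun a b => if a = b then 1 else 0) h i j c d e = 0 := by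
  have hd₁ : ∀ a c d, M a a c d = 0 := fun a c d => by linarith [h₁ a a c d]
  have hd₂ : ∀ a c d, M c d a a = 0 := fun a c d => by linarith [h₂ c d a a]
  have o₁ : ∀ a b c d, b < a → M a b c d = -M b a c d := fun a b c d _ => h₁ a b c d
  have o₂ : ∀ a b c d, d < c → M a b c d = -M a b d c := fun a b c d _ => h₂ a b c d
  have t00 := htr 0 0
  have t01 := htr 0 1
  have t02 := htr 0 2
  have t03 := htr 0 3
  have t10 := htr 1 0
  have t11 := htr 1 1
  have t12 := htr 1 2
  have t13 := htr 1 3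
  have t20 := htr 2 0
  have t21 := htr 2 1
  have t22 := htr 2 2
  have t23 := htr 2 3
  have t30 := htr 3 0
  have t31 := htr 3 1
  have t32 := htr 3 2
  have t33 := htr 3 3
  simp [Fin.sum_univ_four, hd₁, hd₂, o₁, o₂] at t00 t01 t02 t03 t10 t11 t12 t13
  simp [Fin.sum_univ_four, hd₁, hd₂, o₁, o₂] at t20 t21 t22 t23 t30 t31 t32 t33
  refine alternating_eq_zero (F := fun h i j => lanczos M _ h i j c d e) ?_ ?_ ?_ ?_ ?_ ?_ h i j
  · intro h i j
    simp only [lanczos]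
    rw [h₁ h i c d, h₁ h i d e, h₁ h i e c, h₁ i j c d, h₁ i j d e, h₁ i j e c, h₁ j h c d,
      h₁ j h d e, h₁ j h e c]
    ring
  · intro h i j
    simp only [lanczos]
    rw [h₁ h i c d, h₁ h i d e, h₁ h i e c, h₁ i j c d, h₁ i j d e, h₁ i j e c, h₁ j h c d,
      h₁ j h d e, h₁ j h e c]
    ring
  all_goals
    refine alternating_eq_zero (F := fun c d e => lanczos M _ _ _ _ c d e) ?_ ?_ ?_ ?_ ?_ ?_ c d e
    · intro c d e
      simp only [lanczos]
      rw [h₂ _ _ c d, h₂ _ _ d e, h₂ _ _ e c, h₂ _ _ c d, h₂ _ _ d e, h₂ _ _ e c,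
        h₂ _ _ c d, h₂ _ _ d e, h₂ _ _ e c]
      ring
    · intro c d e
      simp only [lanczos]
      rw [h₂ _ _ c d, h₂ _ _ d e, h₂ _ _ e c, h₂ _ _ c d, h₂ _ _ d e, h₂ _ _ e c,
        h₂ _ _ c d, h₂ _ _ d e, h₂ _ _ e c]
      ring
    all_goals
      simp [lanczos, o₁, o₂]
      linarith

theorem eq_zero_of_raise_eq_zero (hg : ∀ a b, g a b = g b a)
    (hginv : ∀ a b, ∑ c, ginv a c * g c b = if a = b then (1 : ℝ) else 0)
    {F : Fin 4 → ℝ} (hF : ∀ p, ∑ c, ginv p c * F c = 0) (x : Fin 4) : F x = 0 := by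
  rw [← metricTrace_metric_mul_left hg (inverseMetric_symm hg hginv) hginv x F]
  refine sum_eq_zero fun i _ => ?_
  rw [← mul_zero (g x i), ← hF i, mul_sum]
  exact sum_congr rfl fun j _ => by ring

theorem sum_sum_sum_mul (P Q R : Fin 4 → ℝ) (A : Fin 4 → Fin 4 → ℝ) (B : Fin 4 → ℝ) :
    ∑ c, P c * ∑ d, Q d * ∑ e, R e * (A c d * B e) =
      (∑ c, ∑ d, P c * Q d * A c d) * ∑ e, R e * B e := by
  rw [sum_mul]
  refine sum_congr rfl fun c _ => ?_
  rw [sum_mul, mul_sum]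
  refine sum_congr rfl fun d _ => ?_
  simp only [mul_sum]
  exact sum_congr rfl fun e _ => by ring

theorem sum_rotate (F : Fin 4 → Fin 4 → Fin 4 → ℝ) :
    ∑ c, ∑ d, ∑ e, F c d e = ∑ d, ∑ e, ∑ c, F c d e := by
  rw [sum_comm]
  exact sum_congr rfl fun d _ => sum_comm

theorem sum_sum_sum_mul_rotate (P Q R : Fin 4 → ℝ) (A : Fin 4 → Fin 4 → ℝ) (B : Fin 4 → ℝ) :
    ∑ c, P c * ∑ d, Q d * ∑ e, R e * (A d e * B c) =
      (∑ d, ∑ e, Q d * R e * A d e) * ∑ c, P c * B c := by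
  rw [← sum_sum_sum_mul]
  simp only [mul_sum]
  rw [sum_rotate]
  exact sum_congr rfl fun c _ => sum_congr rfl fun d _ => sum_congr rfl fun e _ => by ring

/-- The Lanczos identity: antisymmetrizing a Weyl-type array over three index pairs gives `0`. -/
theorem lanczos_eq_zero (hg : ∀ a b, g a b = g b a)
    (hginv : ∀ a b, ∑ c, ginv a c * g c b = if a = b then (1 : ℝ) else 0)
    {W : Fin 4 → Fin 4 → Fin 4 → Fin 4 → ℝ}
    (hW1 : ∀ a b c d, W a b c d = - W b a c d)
    (hW2 : ∀ a b c d, W a b c d = - W a b d c)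
    (hWtr : ∀ b d, ∑ a, ∑ c, ginv a c * W a b c d = 0)
    (h i j c d e : Fin 4) : lanczos W g h i j c d e = 0 := by
  have key : ∀ p q r, ∑ c, ginv p c * ∑ d, ginv q d * ∑ e, ginv r e * lanczos W g h i j c d e =
      lanczos (fun h i p q => ∑ c, ∑ d, ginv p c * ginv q d * W h i c d)
        (fun a b => if a = b then 1 else 0) h i j p q r := by
    intro p q r
    have hδ : ∀ a b, ∑ c, ginv b c * g a c = if a = b then 1 else 0 := fun a b => by
      simp only [hg a, hginv, eq_comm]
    have hrot : ∀ (P Q R : Fin 4 → ℝ) (A : Fin 4 → Fin 4 → ℝ) (B : Fin 4 → ℝ),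
        ∑ c, P c * ∑ d, Q d * ∑ e, R e * (A e c * B d) =
          (∑ e, ∑ c, R e * P c * A e c) * ∑ d, Q d * B d := by
      intro P Q R A B
      rw [← sum_sum_sum_mul_rotate]
      simp only [mul_sum]
      rw [sum_rotate]
      exact sum_congr rfl fun c _ => sum_congr rfl fun d _ => sum_congr rfl fun e _ => by ring
    simp only [lanczos, mul_add, sum_add_distrib, sum_sum_sum_mul, sum_sum_sum_mul_rotate, hrot, hδ]
  have hM : ∀ p q r, lanczos (fun h i p q => ∑ c, ∑ d, ginv p c * ginv q d * W h i c d)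
      (fun a b => if a = b then 1 else 0) h i j p q r = 0 := by
    refine lanczos_one_eq_zero (fun a b c d => ?_) (fun a b c d => ?_) (fun b d => ?_) h i j
    · simp only [hW1 a b, mul_neg, sum_neg_distrib]
    · rw [sum_comm, ← sum_neg_distrib]
      refine sum_congr rfl fun x _ => ?_
      rw [← sum_neg_distrib]
      exact sum_congr rfl fun y _ => by rw [hW2]; ring
    · rw [← sum_rotate fun x a y => ginv a y * ginv d x * W a b y x]
      refine sum_eq_zero fun x _ => ?_
      rw [← mul_zero (ginv d x), ← hWtr b x, mul_sum]
      refine sum_congr rfl fun y _ => ?_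
      rw [mul_sum]
      exact sum_congr rfl fun z _ => by ring
  have h₁ := fun p q => eq_zero_of_raise_eq_zero hg hginv
    (F := fun c => ∑ d, ginv p d * ∑ e, ginv q e * lanczos W g h i j c d e)
    (fun r => (key r p q).trans (hM r p q)) c
  have h₂ := fun p => eq_zero_of_raise_eq_zero hg hginv
    (F := fun d => ∑ e, ginv p e * lanczos W g h i j c d e) (fun q => h₁ q p) d
  exact eq_zero_of_raise_eq_zero hg hginv (F := fun e => lanczos W g h i j c d e) h₂ e

end Lanczos

section Quadratic

variable {g ginv : Fin 4 → Fin 4 → ℝ} {W : Fin 4 → Fin 4 → Fin 4 → Fin 4 → ℝ}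

/-- The contraction `W_{ajmk} W_b{}^j{}_l{}^k`. -/
noncomputable def weylQuad (ginv : Fin 4 → Fin 4 → ℝ) (W : Fin 4 → Fin 4 → Fin 4 → Fin 4 → ℝ)
    (a m b l : Fin 4) : ℝ :=
  metricTrace ginv fun j j' => metricTrace ginv fun k k' => W a j m k * W b j' l k'

/-- The contraction `W_{hide} W^{hi}{}_{jy}`. -/
noncomputable def weylPairQuad (ginv : Fin 4 → Fin 4 → ℝ)
    (W : Fin 4 → Fin 4 → Fin 4 → Fin 4 → ℝ) (d e j y : Fin 4) : ℝ :=
  metricTrace ginv fun h h' => metricTrace ginv fun i i' => W h i d e * W h' i' j y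

/-- The contraction `W_{hicd} W^{hic}{}_y`. -/
noncomputable def weylCubeQuad (ginv : Fin 4 → Fin 4 → ℝ)
    (W : Fin 4 → Fin 4 → Fin 4 → Fin 4 → ℝ) (d y : Fin 4) : ℝ :=
  metricTrace ginv fun h h' => metricTrace ginv fun i i' => metricTrace ginv fun c c' =>
    W h i c d * W h' i' c' y

/-- The square `W_{hicd} W^{hicd}`. -/
noncomputable def weylSq (ginv : Fin 4 → Fin 4 → ℝ)
    (W : Fin 4 → Fin 4 → Fin 4 → Fin 4 → ℝ) : ℝ :=
  metricTrace ginv fun h h' => metricTrace ginv fun i i' => metricTrace ginv fun c c' =>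
    metricTrace ginv fun d d' => W h i c d * W h' i' c' d'

theorem weylQuad_comm (hs : ∀ a b, ginv a b = ginv b a) (a m b l : Fin 4) :
    weylQuad ginv W a m b l = weylQuad ginv W b l a m := by
  unfold weylQuad
  rw [← metricTrace_swap hs]
  refine metricTrace_congr fun j j' => ?_
  rw [← metricTrace_swap hs]
  exact metricTrace_congr fun k k' => mul_comm _ _

theorem weylQuad_transpose (hW3 : ∀ a b c d, W a b c d = W c d a b) (a m b l : Fin 4) :
    weylQuad ginv W a m b l = weylQuad ginv W m a l b := by
  unfold weylQuad
  rw [metricTrace_comm]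
  exact metricTrace_congr fun k k' => metricTrace_congr fun j j' => by rw [hW3 a, hW3 b]

theorem weylPairQuad_eq (hW1 : ∀ a b c d, W a b c d = - W b a c d)
    (hW2 : ∀ a b c d, W a b c d = - W a b d c)
    (hW3 : ∀ a b c d, W a b c d = W c d a b)
    (hW4 : ∀ a b c d, W a b c d + W a c d b + W a d b c = 0) (d e j y : Fin 4) :
    weylPairQuad ginv W d e j y = 2 * (weylQuad ginv W d e j y - weylQuad ginv W d e y j) := by
  have hB : ∀ p q x z, W x p z q - W z p x q = W p q x z := fun p q x z => by
    linarith [hW4 x p z q, hW3 x z q p, hW3 z p x q, hW2 x q p z, hW1 q p x z]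
  have h₁ : weylQuad ginv W d e j y - weylQuad ginv W d e y j =
      metricTrace ginv fun h h' => metricTrace ginv fun i i' => W d h e i * W h' i' j y := by
    simp only [weylQuad, ← metricTrace_sub, ← mul_sub, hB]
  have h₂ : (metricTrace ginv fun h h' => metricTrace ginv fun i i' =>
        W d h e i * W h' i' j y) = -metricTrace ginv fun h h' => metricTrace ginv fun i i' =>
        W e h d i * W h' i' j y := by
    rw [metricTrace_comm, ← metricTrace_neg]
    refine metricTrace_congr fun i i' => ?_
    rw [← metricTrace_neg]
    refine metricTrace_congr fun h h' => ?_
    rw [hW3 d h, hW1 h' i']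
    ring
  have h₃ : weylPairQuad ginv W d e j y =
      (metricTrace ginv fun h h' => metricTrace ginv fun i i' => W d h e i * W h' i' j y) -
      metricTrace ginv fun h h' => metricTrace ginv fun i i' => W e h d i * W h' i' j y := by
    simp only [weylPairQuad, ← metricTrace_sub, ← sub_mul, hB]
  linarith

theorem weylCubeQuad_identity (hg : ∀ a b, g a b = g b a)
    (hginv : ∀ a b, ∑ c, ginv a c * g c b = if a = b then (1 : ℝ) else 0)
    (hW1 : ∀ a b c d, W a b c d = - W b a c d)
    (hW2 : ∀ a b c d, W a b c d = - W a b d c)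
    (hW3 : ∀ a b c d, W a b c d = W c d a b)
    (hWtr : ∀ b d, ∑ a, ∑ c, ginv a c * W a b c d = 0) (j d e y : Fin 4) :
    g j e * weylCubeQuad ginv W d y - g j d * weylCubeQuad ginv W e y
      + weylPairQuad ginv W d e j y - 2 * weylQuad ginv W j d e y
      + 2 * weylQuad ginv W j e d y = 0 := by
  have hs := inverseMetric_symm hg hginv
  have hl := metricTrace_metric_mul_left hg hs hginv
  have htr : ∀ b d, metricTrace ginv (fun a c => W a b c d) = 0 := hWtr
  have h₀ : (metricTrace ginv fun h h' => metricTrace ginv fun i i' => metricTrace ginv fun c c' =>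
      lanczos W g h i j c d e * W h' i' c' y) = 0 := by
    simp only [lanczos_eq_zero hg hginv hW1 hW2 hWtr, zero_mul, metricTrace_zero]
  have hexp : ∀ h h' i i' c c', lanczos W g h i j c d e * W h' i' c' y =
      g j e * (W h i c d * W h' i' c' y) - g j d * (W h i c e * W h' i' c' y)
      + g j c * (W h i d e * W h' i' c' y)
      - g e h * (W j i d c * W h' i' y c') + g d h * (W j i e c * W h' i' y c')
      - g e i * (W j h d c * W i' h' y c') + g d i * (W j h e c * W i' h' y c')
      + g h c * (W i j d e * W c' y h' i') - g i c * (W j h d e * W c' y i' h') := by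
    intro h h' i i' c c'
    simp only [lanczos]
    have h₁ : W h' i' y c' = -W h' i' c' y := hW2 ..
    have h₂ : W i' h' y c' = W h' i' c' y := by rw [hW1, h₁, neg_neg]
    have h₃ : W c' y h' i' = W h' i' c' y := hW3 ..
    have h₄ : W c' y i' h' = -W h' i' c' y := by rw [hW2, h₃]
    rw [h₁, h₂, h₃, h₄, hW1 j i d c, hW1 j i e c, hW2 i j d c, hW2 h i e c, hW2 j h d c,
      hg e h, hg d h, hg e i, hg d i]
    ring
  have hz₁ : (metricTrace ginv fun h h' => metricTrace ginv fun i i' =>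
      W i j d e * W h y h' i') = 0 := by
    rw [metricTrace_comm]
    simp only [metricTrace_const_mul, htr, mul_zero, metricTrace_zero]
  simp only [hexp, metricTrace_add, metricTrace_sub, metricTrace_const_mul, hl, htr, hz₁, mul_zero,
    metricTrace_zero] at h₀
  unfold weylCubeQuad weylPairQuad weylQuad
  linarith

theorem weylCubeQuad_symm (hs : ∀ a b, ginv a b = ginv b a) (d y : Fin 4) :
    weylCubeQuad ginv W d y = weylCubeQuad ginv W y d := by
  unfold weylCubeQuad
  rw [← metricTrace_swap hs]
  refine metricTrace_congr fun h h' => ?_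
  rw [← metricTrace_swap hs]
  refine metricTrace_congr fun i i' => ?_
  rw [← metricTrace_swap hs]
  exact metricTrace_congr fun c c' => mul_comm _ _

theorem metricTrace_weylCubeQuad :
    metricTrace ginv (fun d y => weylCubeQuad ginv W d y) = weylSq ginv W := by
  unfold weylCubeQuad weylSq
  rw [metricTrace_comm]
  refine metricTrace_congr fun h h' => ?_
  rw [metricTrace_comm]
  refine metricTrace_congr fun i i' => ?_
  rw [metricTrace_comm]

theorem weylCubeQuad_eq (hg : ∀ a b, g a b = g b a)
    (hginv : ∀ a b, ∑ c, ginv a c * g c b = if a = b then (1 : ℝ) else 0)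
    (hW1 : ∀ a b c d, W a b c d = - W b a c d)
    (hW2 : ∀ a b c d, W a b c d = - W a b d c)
    (hW3 : ∀ a b c d, W a b c d = W c d a b)
    (hWtr : ∀ b d, ∑ a, ∑ c, ginv a c * W a b c d = 0) (d y : Fin 4) :
    weylCubeQuad ginv W d y = 1 / 4 * g d y * weylSq ginv W := by
  have hs := inverseMetric_symm hg hginv
  have hl := metricTrace_metric_mul_left hg hs hginv
  have htr : ∀ b d, metricTrace ginv (fun a c => W a b c d) = 0 := hWtr
  have hpair : metricTrace ginv (fun p q => weylPairQuad ginv W p y d q) =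
      -weylCubeQuad ginv W y d := by
    unfold weylPairQuad weylCubeQuad
    rw [metricTrace_comm, ← metricTrace_neg]
    refine metricTrace_congr fun h h' => ?_
    rw [metricTrace_comm, ← metricTrace_neg]
    refine metricTrace_congr fun i i' => ?_
    rw [← metricTrace_neg]
    exact metricTrace_congr fun c c' => by rw [hW2 h' i']; ring
  have hquad : metricTrace ginv (fun p q => weylQuad ginv W d p y q) =
      weylCubeQuad ginv W d y := by
    unfold weylQuad weylCubeQuad
    refine metricTrace_congr fun h h' => ?_
    rw [metricTrace_comm]
    refine metricTrace_congr fun i i' => metricTrace_congr fun c c' => ?_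
    rw [hW3 d, hW3 y, hW2 h i, hW2 h' i', neg_mul_neg]
  have hzero : metricTrace ginv (fun p q => weylQuad ginv W d y p q) = 0 := by
    unfold weylQuad
    rw [metricTrace_comm, ← metricTrace_zero]
    refine metricTrace_congr fun i i' => ?_
    rw [metricTrace_comm, ← metricTrace_zero]
    refine metricTrace_congr fun c c' => ?_
    rw [metricTrace_const_mul, htr, mul_zero]
  have h : metricTrace ginv (fun p q => g d y * weylCubeQuad ginv W p q
      - g d p * weylCubeQuad ginv W y q + weylPairQuad ginv W p y d q
      - 2 * weylQuad ginv W d p y q + 2 * weylQuad ginv W d y p q) = 0 := by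
    simp only [weylCubeQuad_identity hg hginv hW1 hW2 hW3 hWtr, metricTrace_zero]
  simp only [metricTrace_add, metricTrace_sub, metricTrace_const_mul, hl, hpair, hquad, hzero,
    metricTrace_weylCubeQuad, weylCubeQuad_symm hs y d] at h
  linarith

/-- The total symmetry of the Bel-Robinson tensor, in terms of quadratic contractions. -/
theorem weylQuad_exchange (hg : ∀ a b, g a b = g b a)
    (hginv : ∀ a b, ∑ c, ginv a c * g c b = if a = b then (1 : ℝ) else 0)
    (hW1 : ∀ a b c d, W a b c d = - W b a c d)
    (hW2 : ∀ a b c d, W a b c d = - W a b d c)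
    (hW3 : ∀ a b c d, W a b c d = W c d a b)
    (hW4 : ∀ a b c d, W a b c d + W a c d b + W a d b c = 0)
    (hWtr : ∀ b d, ∑ a, ∑ c, ginv a c * W a b c d = 0) (a b c h : Fin 4) :
    weylQuad ginv W h b a c + weylQuad ginv W h c a b - 1 / 8 * g h a * g b c * weylSq ginv W =
      weylQuad ginv W a h b c + weylQuad ginv W a c b h
        - 1 / 8 * g a b * g c h * weylSq ginv W := by
  have hs := inverseMetric_symm hg hginv
  have hJ := weylCubeQuad_identity hg hginv hW1 hW2 hW3 hWtr h a c b
  rw [weylPairQuad_eq hW1 hW2 hW3 hW4, weylCubeQuad_eq hg hginv hW1 hW2 hW3 hWtr,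
    weylCubeQuad_eq hg hginv hW1 hW2 hW3 hWtr] at hJ
  rw [weylQuad_comm hs h b, weylQuad_transpose hW3 a h]
  rw [hg c b, hg h c] at hJ
  linarith

end Quadratic

section Dual

variable {g ginv : Fin 4 → Fin 4 → ℝ} {W : Fin 4 → Fin 4 → Fin 4 → Fin 4 → ℝ}

theorem sum_mul_raise (A B : Fin 4 → ℝ) :
    ∑ d, A d * ∑ m, ginv d m * B m = metricTrace ginv fun d m => A d * B m := by
  simp only [metricTrace, mul_sum]
  exact sum_congr rfl fun d _ => sum_congr rfl fun m _ => by ring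

theorem sum_mul_raise₂ (A B : Fin 4 → Fin 4 → ℝ) :
    ∑ j, ∑ k, A j k * ∑ p, ∑ q, ginv j p * ginv k q * B p q =
      metricTrace ginv fun j p => metricTrace ginv fun k q => A j k * B p q := by
  simp only [metricTrace, mul_sum]
  refine sum_congr rfl fun j _ => ?_
  rw [sum_comm]
  exact sum_congr rfl fun p _ => sum_congr rfl fun k _ => sum_congr rfl fun q _ => by ring

theorem sum_mul_raise₄ (A B : Fin 4 → Fin 4 → Fin 4 → Fin 4 → ℝ) :
    ∑ d, ∑ f, ∑ e, ∑ h, A d f e h *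
        ∑ p, ∑ q, ∑ r, ∑ s, ginv d p * ginv f q * ginv e r * ginv h s * B p q r s =
      metricTrace ginv fun d p => metricTrace ginv fun f q => metricTrace ginv fun e r =>
        metricTrace ginv fun h s => A d f e h * B p q r s := by
  have hl : ∀ d f, ∑ e, ∑ h, A d f e h *
        ∑ p, ∑ q, ∑ r, ∑ s, ginv d p * ginv f q * ginv e r * ginv h s * B p q r s =
      ∑ p, ∑ q, ginv d p * ginv f q * metricTrace ginv fun e r =>
        metricTrace ginv fun h s => A d f e h * B p q r s := by
    intro d f
    simp only [← sum_mul_raise₂]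
    simp only [mul_sum]
    refine (sum_congr rfl fun e _ => sum_rotate _).trans ?_
    rw [sum_rotate]
    exact sum_congr rfl fun _ _ => sum_congr rfl fun _ _ => sum_congr rfl fun _ _ =>
      sum_congr rfl fun _ _ => sum_congr rfl fun _ _ => sum_congr rfl fun _ _ => by ring
  simp only [hl]
  rw [metricTrace]
  refine sum_congr rfl fun d _ => ?_
  rw [sum_comm]
  refine sum_congr rfl fun p _ => ?_
  simp only [metricTrace, mul_sum]
  exact sum_congr rfl fun _ _ => sum_congr rfl fun _ _ => sum_congr rfl fun _ _ =>
    sum_congr rfl fun _ _ => sum_congr rfl fun _ _ => sum_congr rfl fun _ _ => by ring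

theorem belRobinson_eq (a b l m : Fin 4) :
    belRobinson g ginv W a b l m = weylQuad ginv W a m b l + weylQuad ginv W a l b m
      - 1 / 8 * g a b * g l m * weylSq ginv W := by
  simp only [belRobinson, sum_mul_raise₂ (fun j k => W a j _ k) (fun p q => W b p _ q),
    sum_mul_raise₄, weylQuad, weylSq]

theorem sum_etaUp3_mul_metric (hg : ∀ a b, g a b = g b a)
    (hginv : ∀ a b, ∑ c, ginv a c * g c b = if a = b then (1 : ℝ) else 0) (p q a s : Fin 4) :
    ∑ r, etaUp3 g ginv p q r s * g r a =
      ∑ p', ∑ q', ginv p p' * ginv q q' * eta4 g p' q' a s := by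
  simp only [etaUp3, sum_mul]
  rw [sum_rotate fun r p' q' => ∑ r', ginv p p' * ginv q q' * ginv r r' * eta4 g p' q' r' s * g r a]
  refine sum_congr rfl fun p' _ => sum_congr rfl fun q' _ => ?_
  rw [← metricTrace_metric_mul_left hg (inverseMetric_symm hg hginv) hginv a
    fun x => eta4 g p' q' x s, metricTrace, mul_sum]
  refine sum_congr rfl fun r _ => ?_
  rw [mul_sum]
  exact sum_congr rfl fun r' _ => by rw [hg a r]; ring

theorem metricTrace_eta4_mul (hg : ∀ a b, g a b = g b a)
    (hginv : ∀ a b, ∑ c, ginv a c * g c b = if a = b then (1 : ℝ) else 0)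
    (hdet : (Matrix.of g).det < 0) (p q a u v h : Fin 4) :
    metricTrace ginv (fun s t => eta4 g p q a s * eta4 g t u v h) = gram3 g p q a u v h := by
  rw [← adjugate_contract_eps4, metricTrace]
  refine sum_congr rfl fun s _ => sum_congr rfl fun t _ => ?_
  rw [← det_mul_inverseMetric hginv, inverseMetric_symm hg hginv t s, eta4, eta4,
    eps4_swap₁₂ t, eps4_swap₂₃ u t, eps4_swap₃₄ u v t]
  linear_combination (-(ginv s t * eps4 p q a s * eps4 u v h t)) *
    Real.mul_self_sqrt (neg_nonneg.mpr hdet.le)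

theorem sum_eta4_mul_etaUp3 (hg : ∀ a b, g a b = g b a)
    (hginv : ∀ a b, ∑ c, ginv a c * g c b = if a = b then (1 : ℝ) else 0)
    (hdet : (Matrix.of g).det < 0) (p q a u v h : Fin 4) :
    ∑ s, eta4 g p q a s * etaUp3 g ginv s u v h =
      ∑ u', ∑ v', ginv u u' * ginv v v' * gram3 g p q a u' v' h := by
  simp only [← metricTrace_eta4_mul hg hginv hdet, etaUp3, metricTrace, mul_sum]
  rw [← sum_rotate fun s u' v' => ∑ t, ginv u u' * ginv v v' *
    (ginv s t * (eta4 g p q a s * eta4 g t u' v' h))]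
  refine sum_congr rfl fun s _ => ?_
  rw [sum_rotate]
  exact sum_congr rfl fun _ _ => sum_congr rfl fun _ _ => sum_congr rfl fun _ _ => by ring

theorem sum_etaUp3_mul_etaUp3 (hg : ∀ a b, g a b = g b a)
    (hginv : ∀ a b, ∑ c, ginv a c * g c b = if a = b then (1 : ℝ) else 0)
    (hdet : (Matrix.of g).det < 0) (p q u v a h : Fin 4) :
    ∑ r, ∑ s, etaUp3 g ginv p q r s * etaUp3 g ginv s u v h * g r a =
      ∑ p', ∑ q', ∑ u', ∑ v', ginv p p' * ginv q q' * ginv u u' * ginv v v' *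
        gram3 g p' q' a u' v' h := by
  have h₁ : ∑ r, ∑ s, etaUp3 g ginv p q r s * etaUp3 g ginv s u v h * g r a =
      ∑ s, (∑ r, etaUp3 g ginv p q r s * g r a) * etaUp3 g ginv s u v h := by
    rw [sum_comm]
    simp only [sum_mul]
    exact sum_congr rfl fun _ _ => sum_congr rfl fun _ _ => by ring
  rw [h₁]
  simp only [sum_etaUp3_mul_metric hg hginv, sum_mul]
  rw [sum_rotate]
  refine sum_congr rfl fun p' _ => sum_congr rfl fun q' _ => ?_
  simp only [mul_assoc, ← mul_sum]
  rw [sum_eta4_mul_etaUp3 hg hginv hdet]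
  simp only [mul_sum, mul_assoc]

theorem sum_raise₄_mul (A B : Fin 4 → Fin 4 → Fin 4 → Fin 4 → ℝ) :
    ∑ d, ∑ f, ∑ e, ∑ h,
        (∑ p, ∑ q, ∑ r, ∑ s, ginv d p * ginv f q * ginv e r * ginv h s * B p q r s) * A d f e h =
      metricTrace ginv fun d p => metricTrace ginv fun f q => metricTrace ginv fun e r =>
        metricTrace ginv fun h s => B p q r s * A d f e h := by
  simp only [mul_comm _ (A _ _ _ _), sum_mul_raise₄]

theorem sum_etaUp3_contract (hg : ∀ a b, g a b = g b a)
    (hginv : ∀ a b, ∑ c, ginv a c * g c b = if a = b then (1 : ℝ) else 0)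
    (hdet : (Matrix.of g).det < 0) {X : Fin 4 → Fin 4 → Fin 4 → Fin 4 → ℝ}
    (hX₁ : ∀ p q u v, X p q u v = -X q p u v) (hX₂ : ∀ p q u v, X p q u v = -X p q v u)
    (a h : Fin 4) :
    ∑ p, ∑ q, ∑ r, ∑ s, ∑ u, ∑ v,
        etaUp3 g ginv p q r s * etaUp3 g ginv s u v h * g r a * X p q u v =
      2 * g a h * metricTrace ginv (fun p p' => metricTrace ginv fun q q' => X p q p' q')
        - 4 * metricTrace ginv (fun p p' => X p h p' a) := by
  have hs := inverseMetric_symm hg hginv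
  have hr := metricTrace_metric_mul_right hg hs hginv
  have h₁ : ∀ p q, ∑ r, ∑ s, ∑ u, ∑ v,
        etaUp3 g ginv p q r s * etaUp3 g ginv s u v h * g r a * X p q u v =
      ∑ u, ∑ v, (∑ r, ∑ s, etaUp3 g ginv p q r s * etaUp3 g ginv s u v h * g r a) *
        X p q u v := by
    intro p q
    simp only [sum_mul]
    rw [← sum_rotate fun r u v => ∑ s, etaUp3 g ginv p q r s * etaUp3 g ginv s u v h * g r a *
      X p q u v]
    exact sum_congr rfl fun r _ => sum_rotate _
  have hexp : ∀ p p' q q' u u' v v', gram3 g p' q' a u' v' h * X p q u v =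
      g a h * (g p' u' * (g q' v' * X p q u v)) - g h q' * (g p' u' * (g a v' * X p q u v))
      - g a h * (g q' u' * (g p' v' * X p q u v)) + g h q' * (g a u' * (g p' v' * X p q u v))
      + g h p' * (g q' u' * (g a v' * X p q u v)) - g h p' * (g a u' * (g q' v' * X p q u v)) := by
    intro p p' q q' u u' v v'
    rw [gram3, hg h q', hg h p']
    ring
  simp only [h₁, sum_etaUp3_mul_etaUp3 hg hginv hdet, sum_raise₄_mul, hexp, metricTrace_add,
    metricTrace_sub, metricTrace_const_mul, hr]
  have e₁ : (metricTrace ginv fun p p' => metricTrace ginv fun q q' => X p q q' p') =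
      -metricTrace ginv fun p p' => metricTrace ginv fun q q' => X p q p' q' := by
    simp only [← metricTrace_neg, ← hX₂]
  have e₂ : (metricTrace ginv fun p p' => X p h a p') =
      -metricTrace ginv fun p p' => X p h p' a := by
    simp only [← metricTrace_neg, ← hX₂]
  have e₃ : (metricTrace ginv fun p p' => X h p p' a) =
      -metricTrace ginv fun p p' => X p h p' a := by
    simp only [← metricTrace_neg, ← hX₁]
  have e₄ : (metricTrace ginv fun p p' => X h p a p') =
      metricTrace ginv fun p p' => X p h p' a := by
    rw [← neg_neg (metricTrace ginv fun p p' => X p h p' a), ← e₂, ← metricTrace_neg]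
    simp only [← hX₁]
  rw [e₁, e₂, e₃, e₄]
  ring

end Dual

/-- Component form of the Proposition stating that the Hodge dual of the Bel-Robinson
3-form `𝒯_{abc} = Ω^{ed}{}_{abc}∧𝒲_{ed}` equals `θ^{d} T_{abcd}`. -/
theorem belRobinson_threeform_dual
    (g ginv : Fin 4 → Fin 4 → ℝ)
    (hg : ∀ a b, g a b = g b a)
    (hginv : ∀ a b, ∑ c, ginv a c * g c b = if a = b then (1 : ℝ) else 0)
    (hdet : (Matrix.of g).det < 0)
    (W : Fin 4 → Fin 4 → Fin 4 → Fin 4 → ℝ)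
    (hW1 : ∀ a b c d, W a b c d = - W b a c d)
    (hW2 : ∀ a b c d, W a b c d = - W a b d c)
    (hW3 : ∀ a b c d, W a b c d = W c d a b)
    (hW4 : ∀ a b c d, W a b c d + W a c d b + W a d b c = 0)
    (hWtr : ∀ b d, ∑ a, ∑ c, ginv a c * W a b c d = 0)
    (a b c h : Fin 4) :
    (1 / 4) * (∑ p, ∑ q, ∑ r, ∑ s, ∑ u, ∑ v,
        etaUp3 g ginv p q r s * etaUp3 g ginv s u v h * g r a *
          (-(∑ d, W p q d b * (∑ m, ginv d m * W u v m c))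
            - (∑ d, W p q d c * (∑ m, ginv d m * W u v m b))
            + (1 / 2) * g b c *
              (∑ e, ∑ d, W p q e d * (∑ m, ∑ n, ginv e m * ginv d n * W u v m n))))
      = belRobinson g ginv W a b c h := by
  have hs := inverseMetric_symm hg hginv
  have hX := sum_etaUp3_contract hg hginv hdet
    (X := fun p q u v =>
      -metricTrace ginv (fun d m => W p q d b * W u v m c)
        - metricTrace ginv (fun d m => W p q d c * W u v m b)
        + 1 / 2 * g b c * metricTrace ginv (fun e m => metricTrace ginv fun d n =>
          W p q e d * W u v m n))
    (fun p q u v => by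
      simp only [hW1 p q, neg_mul, metricTrace_neg]; ring)
    (fun p q u v => by
      simp only [hW1 u v, mul_neg, metricTrace_neg]; ring) a h
  have hcube : ∀ x y, (metricTrace ginv fun p p' => metricTrace ginv fun q q' =>
      metricTrace ginv fun d m => W p q d x * W p' q' m y) = 1 / 4 * g x y * weylSq ginv W :=
    weylCubeQuad_eq hg hginv hW1 hW2 hW3 hWtr
  have hsq : (metricTrace ginv fun p p' => metricTrace ginv fun q q' =>
      metricTrace ginv fun e m => metricTrace ginv fun d n => W p q e d * W p' q' m n) =
      weylSq ginv W := rfl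
  have hquad : ∀ x y, (metricTrace ginv fun p p' => metricTrace ginv fun d m =>
      W p h d x * W p' a m y) = weylQuad ginv W h x a y := fun x y =>
    metricTrace_congr fun p p' => metricTrace_congr fun d m => by
      rw [hW1 p, hW2 h, hW1 p', hW2 a, neg_neg, neg_neg]
  have hcube' : (metricTrace ginv fun p p' => metricTrace ginv fun e m =>
      metricTrace ginv fun d n => W p h e d * W p' a m n) = 1 / 4 * g h a * weylSq ginv W := by
    rw [← hcube, metricTrace_comm]
    refine metricTrace_congr fun e m => ?_
    rw [metricTrace_comm]
    exact metricTrace_congr fun d n => metricTrace_congr fun p p' => by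
      rw [hW3 p, hW3 p', hW2 e d, hW2 m n, neg_mul_neg]
  simp only [metricTrace_add, metricTrace_sub, metricTrace_neg, metricTrace_const_mul, hcube, hsq,
    hquad, hcube', hg c b, hg a h] at hX
  simp only [sum_mul_raise (fun d => W _ _ d _) (fun m => W _ _ m _),
    sum_mul_raise₂ (fun e d => W _ _ e d) (fun m n => W _ _ m n)]
  rw [hX, belRobinson_eq, ← weylQuad_exchange hg hginv hW1 hW2 hW3 hW4 hWtr]
  ring
end

section
/- Let g be a symmetric invertible 4×4 real matrix and let W have Weyl symmetries with respect to g. Then the Bel-Robinson tensor T of W is traceless: Σ_{a,b} g^{ab} T_{ablm} = 0 for all l,m in Fin 4. -/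
open Finset

/-- Interchanging two consecutive pairs of summation indices. -/
lemma sum_pair_comm {ι : Type*} [Fintype ι] {A : Type*} [AddCommMonoid A]
    (f : ι → ι → ι → ι → A) :
    ∑ a, ∑ b, ∑ c, ∑ d, f a b c d = ∑ c, ∑ d, ∑ a, ∑ b, f a b c d := by
  rw [Finset.sum_comm_cycle]
  exact Finset.sum_congr rfl fun c _ => Finset.sum_comm_cycle

set_option maxHeartbeats 4000000 in
/-- The Gauss-Bonnet-Lanczos identity in dimension four, for an array `M a b c d`
(read as `M^{ab}_{cd}`) which is antisymmetric in each pair of indices, without any metric. -/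
lemma lanczos_identity (M : Fin 4 → Fin 4 → Fin 4 → Fin 4 → ℝ)
    (h1 : ∀ a b c d, M a b c d = -M b a c d) (h2 : ∀ a b c d, M a b c d = -M a b d c)
    (R : Fin 4 → Fin 4 → ℝ) (hR : ∀ b d, R b d = ∑ a, M a b a d) (l m : Fin 4) :
    ∑ a, ∑ j, ∑ k, M a j m k * M l k a j
      = 2 * (∑ c, R l c * R c m) + 2 * (∑ c, ∑ d, M l c m d * R d c) - (∑ c, R c c) * R l m
        + (if l = m then (1 / 4 : ℝ) else 0) *
          ((∑ a, ∑ j, ∑ b, ∑ k, M a j b k * M b k a j) + (∑ c, R c c) ^ 2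
            - 4 * ∑ c, ∑ d, R c d * R d c) := by
  have d1 : ∀ a c d, M a a c d = 0 := fun a c d => by linarith [h1 a a c d]
  have d2 : ∀ a b c, M a b c c = 0 := fun a b c => by linarith [h2 a b c c]
  have u1 := h1 1 0
  have u2 := h1 2 0
  have u3 := h1 3 0
  have u4 := h1 2 1
  have u5 := h1 3 1
  have u6 := h1 3 2
  have v1 := fun a b => h2 a b 1 0
  have v2 := fun a b => h2 a b 2 0
  have v3 := fun a b => h2 a b 3 0
  have v4 := fun a b => h2 a b 2 1
  have v5 := fun a b => h2 a b 3 1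
  have v6 := fun a b => h2 a b 3 2
  clear h1 h2
  fin_cases l <;> fin_cases m <;>
    simp [Fin.sum_univ_four, hR, d1, d2, u1, u2, u3, u4, u5, u6, v1, v2, v3, v4, v5, v6] <;>
    ring

/-- In dimension four, a traceless array `M^{ab}_{cd}` antisymmetric in each pair satisfies
`M^{aj}_{mk} M^{lk}_{aj} = (1/4) δ^l_m M^{aj}_{bk} M^{bk}_{aj}`. -/
lemma sum_mul_eq_of_traceless (M : Fin 4 → Fin 4 → Fin 4 → Fin 4 → ℝ)
    (h1 : ∀ a b c d, M a b c d = -M b a c d) (h2 : ∀ a b c d, M a b c d = -M a b d c)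
    (htr : ∀ b d, ∑ a, M a b a d = 0) (l m : Fin 4) :
    ∑ a, ∑ j, ∑ k, M a j m k * M l k a j
      = (if l = m then (1 / 4 : ℝ) else 0) * ∑ a, ∑ j, ∑ b, ∑ k, M a j b k * M b k a j := by
  simpa using lanczos_identity M h1 h2 (fun _ _ => 0) (fun b d => (htr b d).symm) l m

/-- The Bel-Robinson tensor is traceless: `g^{ab} T_{ablm} = 0`. -/
theorem belRobinson_traceless
    (g ginv : Fin 4 → Fin 4 → ℝ)
    (hg : ∀ a b, g a b = g b a)
    (hginv : ∀ a b, ∑ c, ginv a c * g c b = if a = b then (1 : ℝ) else 0)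
    (W : Fin 4 → Fin 4 → Fin 4 → Fin 4 → ℝ)
    (hW1 : ∀ a b c d, W a b c d = - W b a c d)
    (hW2 : ∀ a b c d, W a b c d = - W a b d c)
    (hW3 : ∀ a b c d, W a b c d = W c d a b)
    (hW4 : ∀ a b c d, W a b c d + W a c d b + W a d b c = 0)
    (hWtr : ∀ b d, ∑ a, ∑ c, ginv a c * W a b c d = 0)
    (l m : Fin 4) :
    ∑ a, ∑ b, ginv a b * belRobinson g ginv W a b l m = 0 := by
  have hmul : (Matrix.of ginv) * (Matrix.of g) = 1 := by
    ext a b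
    simpa [Matrix.mul_apply, Matrix.one_apply] using hginv a b
  have hmul' : (Matrix.of g) * (Matrix.of ginv) = 1 := mul_eq_one_comm.mp hmul
  have hgT : (Matrix.of g).transpose = Matrix.of g := by
    ext a b
    exact hg b a
  have hsymm : ∀ a b, ginv a b = ginv b a := by
    have h : (Matrix.of ginv).transpose = Matrix.of ginv := by
      refine left_inv_eq_right_inv (a := Matrix.of g) ?_ hmul'
      have e := congrArg Matrix.transpose hmul'
      rwa [Matrix.transpose_mul, hgT, Matrix.transpose_one] at e
    intro a b
    exact congrFun (congrFun h b) a
  have hdelta : ∀ a b, ∑ c, g a c * ginv c b = if a = b then (1 : ℝ) else 0 := by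
    intro a b
    simpa [Matrix.mul_apply, Matrix.one_apply] using congrFun (congrFun hmul' a) b
  set M : Fin 4 → Fin 4 → Fin 4 → Fin 4 → ℝ :=
    fun a b c d => ∑ p, ∑ q, ginv a p * ginv b q * W p q c d with hM
  have h1 : ∀ a b c d, M a b c d = -M b a c d := by
    intro a b c d
    simp only [hM]
    rw [Finset.sum_comm, ← Finset.sum_neg_distrib]
    refine Finset.sum_congr rfl fun q _ => ?_
    rw [← Finset.sum_neg_distrib]
    refine Finset.sum_congr rfl fun p _ => ?_
    rw [hW1 p q]
    ring
  have h2 : ∀ a b c d, M a b c d = -M a b d c := by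
    intro a b c d
    simp only [hM, ← Finset.sum_neg_distrib]
    refine Finset.sum_congr rfl fun p _ => Finset.sum_congr rfl fun q _ => ?_
    rw [hW2 p q]
    ring
  have htr : ∀ b d, ∑ a, M a b a d = 0 := by
    intro b d
    have h : ∑ a, M a b a d = ∑ q, ginv b q * ∑ a, ∑ p, ginv a p * W a q p d := by
      simp only [hM, Finset.mul_sum]
      rw [Finset.sum_comm_cycle]
      refine Finset.sum_congr rfl fun q _ => ?_
      rw [Finset.sum_comm]
      refine Finset.sum_congr rfl fun p _ => Finset.sum_congr rfl fun a _ => ?_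
      rw [hsymm a p]
      ring
    simp [h, hWtr]
  have hlow : ∀ l k b p, ∑ q, ginv k q * W b p l q = ∑ s, g l s * M s k b p := by
    intro l k b p
    have h : ∑ s, g l s * M s k b p
        = ∑ t, (∑ s, g l s * ginv s t) * ∑ q, ginv k q * W t q b p := by
      simp only [hM, Finset.mul_sum, Finset.sum_mul]
      rw [Finset.sum_comm]
      refine Finset.sum_congr rfl fun t _ => ?_
      rw [Finset.sum_comm]
      refine Finset.sum_congr rfl fun q _ => Finset.sum_congr rfl fun s _ => ?_
      ring
    rw [h]
    simp [hdelta, hW3 b p]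
  set N := ∑ a, ∑ j, ∑ b, ∑ k, M a j b k * M b k a j with hN
  have hquad : ∀ l m, ∑ a, ∑ b, ginv a b *
      (∑ j, ∑ k, W a j m k * (∑ p, ∑ q, ginv j p * ginv k q * W b p l q))
        = 1 / 4 * g l m * N := by
    intro l m
    have h : ∑ a, ∑ b, ginv a b *
        (∑ j, ∑ k, W a j m k * (∑ p, ∑ q, ginv j p * ginv k q * W b p l q))
          = ∑ s, g l s * ∑ b, ∑ p, ∑ k, M b p m k * M s k b p := by
      have hraise : ∀ a b, ginv a b *
          (∑ j, ∑ k, W a j m k * (∑ p, ∑ q, ginv j p * ginv k q * W b p l q))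
            = ∑ j, ∑ k, ∑ p,
              ginv b a * ginv p j * W a j m k * ∑ s, g l s * M s k b p := by
        intro a b
        simp only [← hlow, Finset.mul_sum]
        refine Finset.sum_congr rfl fun j _ => Finset.sum_congr rfl fun k _ =>
          Finset.sum_congr rfl fun p _ => Finset.sum_congr rfl fun q _ => ?_
        rw [hsymm a b, hsymm j p]
        ring
      have hcontract : ∑ s, g l s * ∑ b, ∑ p, ∑ k, M b p m k * M s k b p
          = ∑ b, ∑ p, ∑ k, M b p m k * ∑ s, g l s * M s k b p := by
        simp only [Finset.mul_sum]
        rw [Finset.sum_comm]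
        refine Finset.sum_congr rfl fun b _ => ?_
        rw [Finset.sum_comm]
        refine Finset.sum_congr rfl fun p _ => ?_
        rw [Finset.sum_comm]
        refine Finset.sum_congr rfl fun k _ => Finset.sum_congr rfl fun s _ => ?_
        ring
      rw [hcontract]
      simp only [hraise]
      rw [Finset.sum_comm]
      refine Finset.sum_congr rfl fun b _ => ?_
      simp only [hM, Finset.sum_mul]
      calc
        _ = ∑ a, ∑ j, ∑ p, ∑ k, ginv b a * ginv p j * W a j m k *
              ∑ s, g l s * M s k b p :=
          Finset.sum_congr rfl fun a _ => Finset.sum_congr rfl fun j _ => Finset.sum_comm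
        _ = _ := sum_pair_comm _
    rw [h]
    simp only [sum_mul_eq_of_traceless M h1 h2 htr, ← hN]
    simp
    ring
  have hnorm : ∑ d, ∑ f, ∑ e, ∑ h, W d f e h *
      (∑ p, ∑ q, ∑ r, ∑ s, ginv d p * ginv f q * ginv e r * ginv h s * W p q r s) = N := by
    have hinner : ∀ d f e h,
        ∑ p, ∑ q, ∑ r, ∑ s, ginv d p * ginv f q * ginv e r * ginv h s * W p q r s
          = ∑ p, ∑ q, ginv p d * ginv q f * M e h p q := by
      intro d f e h
      simp only [hM, Finset.mul_sum]
      refine Finset.sum_congr rfl fun p _ => Finset.sum_congr rfl fun q _ =>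
        Finset.sum_congr rfl fun r _ => Finset.sum_congr rfl fun s _ => ?_
      rw [hW3 p q, hsymm d p, hsymm f q]
      ring
    have hexpand : ∀ a j b k, M a j b k * M b k a j
        = ∑ p, ∑ q, W p q b k * (ginv a p * ginv j q * M b k a j) := by
      intro a j b k
      conv_lhs => rw [hM]
      simp only [Finset.sum_mul]
      refine Finset.sum_congr rfl fun p _ => Finset.sum_congr rfl fun q _ => ?_
      ring
    simp only [hN, hinner, hexpand, Finset.mul_sum]
    calc
      _ = ∑ d, ∑ f, ∑ p, ∑ q, ∑ e, ∑ h,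
            W d f e h * (ginv p d * ginv q f * M e h p q) :=
        Finset.sum_congr rfl fun d _ => Finset.sum_congr rfl fun f _ => sum_pair_comm _
      _ = ∑ p, ∑ q, ∑ d, ∑ f, ∑ e, ∑ h,
            W d f e h * (ginv p d * ginv q f * M e h p q) := sum_pair_comm _
      _ = _ :=
        Finset.sum_congr rfl fun p _ => Finset.sum_congr rfl fun q _ => sum_pair_comm _
  have htrace : ∑ a, ∑ b, ginv a b * g a b = 4 := by
    have h : ∀ a, ∑ b, ginv a b * g a b = 1 := fun a => by
      simpa [hg a] using hginv a a
    simp [h]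
  have hsplit : ∑ a, ∑ b, ginv a b * belRobinson g ginv W a b l m
      = 1 / 4 * g l m * N + 1 / 4 * g m l * N
        - 1 / 8 * g l m * N * ∑ a, ∑ b, ginv a b * g a b := by
    rw [← hquad l m, ← hquad m l]
    rw [Finset.mul_sum, ← Finset.sum_add_distrib, ← Finset.sum_sub_distrib]
    refine Finset.sum_congr rfl fun a _ => ?_
    rw [Finset.mul_sum, ← Finset.sum_add_distrib, ← Finset.sum_sub_distrib]
    refine Finset.sum_congr rfl fun b _ => ?_
    rw [belRobinson, hnorm]
    ring
  rw [hsplit, htrace, hg m l]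
  ring
end
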